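/- Let q be an odd prime power with q ≥ 7, let a ∈ F_q with a ≠ 0, let b ∈ F_q, and let r ∈ F_{q^2} with r ∉ F_q and r^2 ∈ F_q. Define f: F_q → F_{q^2} by f(x) = a·x^2 + b·x + 1/(x − r) + 1/(x + r). Then the sum over all x ∈ F_q of f(x)^2 equals −(1 + 4·b·r^2) / (2·r^2). -/

import Mathlib

open Finset in
theorem FiniteField.sum_algebraMap_add_pow_eq_zero {F K : Type*} [Field F] [Fintype F] [Field K]
    [Algebra F K] (c : K) {k : ℕ} (hk : k < Fintype.card F - 1) :
    ∑ x : F, (algebraMap F K x + c) ^ k = 0 := by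
  simp_rw [add_pow]
  rw [sum_comm]
  refine sum_eq_zero fun j hj => ?_
  rw [← sum_mul, ← sum_mul]
  simp_rw [← map_pow]
  rw [← map_sum, FiniteField.sum_pow_lt_card_sub_one F j (by simp at hj; omega)]
  simp

theorem FiniteField.sum_pow_card_sub_one {F : Type*} [Field F] [Fintype F] :
    ∑ x : F, x ^ (Fintype.card F - 1) = -1 := by
  classical
  have hcard := Fintype.one_lt_card (α := F)
  have h : ∀ x : F, x ^ (Fintype.card F - 1) = 1 - if x = 0 then 1 else 0 := by
    intro x
    split_ifs with hx
    · simp [hx, show Fintype.card F - 1 ≠ 0 by omega]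
    · simp [FiniteField.pow_card_sub_one_eq_one x hx]
  simp [h]

open Finset in
theorem FiniteField.sum_algebraMap_add_pow_card_sub_one {F K : Type*} [Field F] [Fintype F]
    [Field K] [Algebra F K] (c : K) :
    ∑ x : F, (algebraMap F K x + c) ^ (Fintype.card F - 1) = -1 := by
  simp_rw [add_pow]
  rw [sum_comm, sum_range_succ, sum_eq_zero]
  · have h := congrArg (algebraMap F K) (FiniteField.sum_pow_card_sub_one (F := F))
    simpa using h
  · intro j hj
    rw [← sum_mul, ← sum_mul]
    simp_rw [← map_pow]
    rw [← map_sum, FiniteField.sum_pow_lt_card_sub_one F j (by simpa using hj)]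
    simp

theorem FiniteField.inv_algebraMap_add {F K : Type*} [Field F] [Fintype F] [Field K]
    [Algebra F K] {c : K} (hc : c ^ Fintype.card F = -c) (hc2 : 2 * c ≠ 0) (x : F) :
    (algebraMap F K x + c)⁻¹
      = (1 - (algebraMap F K x + c) ^ (Fintype.card F - 1)) / (2 * c) := by
  have h1 : (algebraMap F K x + c) ^ Fintype.card F = algebraMap F K x - c := by
    have := map_add (FiniteField.frobeniusAlgHom F K) (algebraMap F K x) c
    rw [AlgHom.commutes] at this
    simpa [hc, sub_eq_add_neg] using this
  obtain ⟨n, hn⟩ : ∃ n, Fintype.card F = n + 1 :=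
    ⟨_, (Nat.succ_pred_eq_of_pos Fintype.card_pos).symm⟩
  rw [hn, pow_succ] at h1
  rw [hn, Nat.add_sub_cancel, inv_eq_iff_eq_inv, inv_div, eq_div_iff]
  · linear_combination -h1
  · intro h
    apply hc2
    linear_combination (algebraMap F K x + c) * h + h1

theorem FiniteField.sum_inv_algebraMap_add {F K : Type*} [Field F] [Fintype F] [Field K]
    [Algebra F K] {c : K} (hc : c ^ Fintype.card F = -c) (hc2 : 2 * c ≠ 0) :
    ∑ x : F, (algebraMap F K x + c)⁻¹ = (2 * c)⁻¹ := by
  have hq : (Fintype.card F : K) = 0 := by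
    rw [← map_natCast (algebraMap F K), FiniteField.cast_card_eq_zero, map_zero]
  simp_rw [FiniteField.inv_algebraMap_add hc hc2]
  rw [← Finset.sum_div, Finset.sum_sub_distrib, FiniteField.sum_algebraMap_add_pow_card_sub_one]
  simp [hq]

theorem FiniteField.sum_inv_algebraMap_add_sq {F K : Type*} [Field F] [Fintype F] [Field K]
    [Algebra F K] {c : K} (hc : c ^ Fintype.card F = -c) (hc2 : 2 * c ≠ 0)
    (hx : ∀ x : F, algebraMap F K x + c ≠ 0) (hF : 2 < Fintype.card F) :
    ∑ x : F, ((algebraMap F K x + c)⁻¹) ^ 2 = ((2 * c)⁻¹) ^ 2 := by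
  have h : ∀ x : F, ((algebraMap F K x + c)⁻¹) ^ 2
      = ((algebraMap F K x + c)⁻¹ - (algebraMap F K x + c) ^ (Fintype.card F - 2))
        * (2 * c)⁻¹ := by
    intro x
    obtain ⟨n, hn⟩ : ∃ n, Fintype.card F = n + 2 := ⟨_, (Nat.sub_add_cancel hF.le).symm⟩
    have h1 := FiniteField.inv_algebraMap_add hc hc2 x
    rw [hn, show n + 2 - 1 = n + 1 from rfl, pow_succ, div_eq_mul_inv] at h1
    rw [hn, Nat.add_sub_cancel]
    have h2 := inv_mul_cancel₀ (hx x)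
    linear_combination (algebraMap F K x + c)⁻¹ * h1
      - (2 * c)⁻¹ * (algebraMap F K x + c) ^ n * h2
  simp_rw [h]
  rw [← Finset.sum_mul, Finset.sum_sub_distrib, FiniteField.sum_inv_algebraMap_add hc hc2,
    FiniteField.sum_algebraMap_add_pow_eq_zero c (by omega)]
  ring

theorem FiniteField.pow_card_eq_neg_of_sq_mem_range {F K : Type*} [Field F] [Fintype F] [Field K]
    [Algebra F K] (hF : ringChar F ≠ 2) {r : K} (hr : r ∉ Set.range (algebraMap F K))
    (hr2 : r ^ 2 ∈ Set.range (algebraMap F K)) : r ^ Fintype.card F = -r := by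
  obtain ⟨s, hs⟩ := hr2
  have hs0 : s ≠ 0 := by
    rintro rfl
    rw [map_zero, eq_comm, sq_eq_zero_iff] at hs
    exact hr ⟨0, by rw [hs, map_zero]⟩
  have hsq : ¬ IsSquare s := by
    rintro ⟨t, rfl⟩
    rw [map_mul, ← sq] at hs
    rcases sq_eq_sq_iff_eq_or_eq_neg.mp hs with h | h
    · exact hr ⟨t, h⟩
    · exact hr ⟨-t, by rw [map_neg, h, neg_neg]⟩
  rw [FiniteField.isSquare_iff hF hs0] at hsq
  have h1 := (FiniteField.pow_dichotomy hF hs0).resolve_left hsq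
  have h2 := FiniteField.odd_card_of_char_ne_two hF
  have h3 : Fintype.card F = 2 * (Fintype.card F / 2) + 1 := by omega
  rw [h3, pow_succ, pow_mul, ← hs, ← map_pow, h1]
  simp


/-- For `q` odd, `q ≥ 7`, `a ∈ F_q*`, `b ∈ F_q`, `r ∈ F_{q²} \ F_q` with `r² ∈ F_q`,
and `f(x) = a·x² + b·x + 1/(x - r) + 1/(x + r)`,
`∑_{x ∈ F_q} f(x)² = -(1 + 4·b·r²) / (2·r²)`. -/
theorem stmt_13 (q : ℕ) (hq : IsPrimePow q) (hodd : Odd q) (hq7 : 7 ≤ q)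
    (F K : Type*) [Field F] [Fintype F] [Field K] [Fintype K] [Algebra F K]
    (hF : Fintype.card F = q) (hK : Fintype.card K = q ^ 2)
    (a : F) (ha : a ≠ 0) (b : F)
    (r : K) (hr : r ∉ Set.range (algebraMap F K))
    (hr2 : r ^ 2 ∈ Set.range (algebraMap F K)) :
    ∑ x : F, (algebraMap F K (a * x ^ 2 + b * x) + (algebraMap F K x - r)⁻¹
        + (algebraMap F K x + r)⁻¹) ^ 2
      = -(1 + 4 * algebraMap F K b * r ^ 2) / (2 * r ^ 2) := by
  subst hF
  have hchar : ringChar F ≠ 2 := fun h => by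
    have := FiniteField.even_card_of_char_two h
    rw [Nat.odd_iff] at hodd
    omega
  have hrq := FiniteField.pow_card_eq_neg_of_sq_mem_range hchar hr hr2
  have hr0 : r ≠ 0 := by
    rintro rfl
    exact hr ⟨0, map_zero _⟩
  have h20 : (2 : K) ≠ 0 := by
    rw [← map_ofNat (algebraMap F K) 2]
    simpa using Ring.two_ne_zero hchar
  have hp : ∀ x : F, algebraMap F K x + r ≠ 0 := fun x h =>
    hr ⟨-x, by rw [map_neg]; linear_combination -h⟩
  have hm : ∀ x : F, algebraMap F K x + -r ≠ 0 := fun x h =>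
    hr ⟨x, by linear_combination h⟩
  have hrq' : (-r) ^ Fintype.card F = - -r := by rw [hodd.neg_pow, hrq]
  have h2r : 2 * r ≠ 0 := mul_ne_zero h20 hr0
  have h2r' : 2 * -r ≠ 0 := mul_ne_zero h20 (neg_ne_zero.mpr hr0)
  have hu := FiniteField.sum_inv_algebraMap_add hrq' h2r'
  have hv := FiniteField.sum_inv_algebraMap_add hrq h2r
  have hu2 := FiniteField.sum_inv_algebraMap_add_sq hrq' h2r' hm (by omega)
  have hv2 := FiniteField.sum_inv_algebraMap_add_sq hrq h2r hp (by omega)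
  have hpow : ∀ k < 5, ∑ x : F, algebraMap F K x ^ k = 0 := fun k hk => by
    simpa using FiniteField.sum_algebraMap_add_pow_eq_zero (F := F) (0 : K) (k := k) (by omega)
  set A := algebraMap F K a
  set B := algebraMap F K b
  have key : ∀ x : F, (algebraMap F K (a * x ^ 2 + b * x) + (algebraMap F K x - r)⁻¹
        + (algebraMap F K x + r)⁻¹) ^ 2
      = A ^ 2 * algebraMap F K x ^ 4 + 2 * A * B * algebraMap F K x ^ 3
        + B ^ 2 * algebraMap F K x ^ 2 + 4 * A * algebraMap F K x ^ 1
        + 4 * B * algebraMap F K x ^ 0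
        + (2 * A * r ^ 2 + 2 * B * r + r⁻¹) * (algebraMap F K x + -r)⁻¹
        + (2 * A * r ^ 2 - 2 * B * r - r⁻¹) * (algebraMap F K x + r)⁻¹
        + ((algebraMap F K x + -r)⁻¹) ^ 2 + ((algebraMap F K x + r)⁻¹) ^ 2 := by
    intro x
    have h1 := hp x
    have h2 := hm x
    simp only [map_add, map_mul, map_pow, sub_eq_add_neg]
    field_simp
    ring
  simp_rw [key, Finset.sum_add_distrib, ← Finset.mul_sum]
  rw [hu, hv, hu2, hv2, hpow 0 (by omega), hpow 1 (by omega), hpow 2 (by omega),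
    hpow 3 (by omega), hpow 4 (by omega)]
  field_simp
  ring
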